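/- Let Z = X ∪ Y be a finite nonempty set of even integers with 0 ∉ Z that is the imbalance set of some tournament, where X = {x₁, …, x_l} is the set of positive elements and Y = {−y₁, …, −y_m} is the set of negative elements of Z, both nonempty. Let L = x₁ + ⋯ + x_l, M = y₁ + ⋯ + y_m and n = lM + mL. Then the minimal order of a tournament whose imbalance set is Z is strictly less than 2n. -/

import Mathlib

/-- A tournament on `Fin n`: loopless, and between any two distinct vertices
there is exactly one arc. -/
def IsTournament {n : ℕ} (r : Fin n → Fin n → Bool) : Prop :=
  (∀ i, r i i = false) ∧ ∀ i j : Fin n, i ≠ j → (r i j = !(r j i))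

/-- The score (outdegree) of vertex `i`. -/
def outdeg {n : ℕ} (r : Fin n → Fin n → Bool) (i : Fin n) : ℕ :=
  (Finset.univ.filter fun j => r i j = true).card

/-- The indegree of vertex `i`. -/
def indeg {n : ℕ} (r : Fin n → Fin n → Bool) (i : Fin n) : ℕ :=
  (Finset.univ.filter fun j => r j i = true).card

/-- The imbalance of vertex `i`: outdegree minus indegree. -/
def imbalance {n : ℕ} (r : Fin n → Fin n → Bool) (i : Fin n) : ℤ :=
  (outdeg r i : ℤ) - (indeg r i : ℤ)

/-- The imbalance set of a digraph. -/
def imbalanceSet {n : ℕ} (r : Fin n → Fin n → Bool) : Finset ℤ :=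
  Finset.image (imbalance r) Finset.univ

section helpers

/-- Signed arc value. -/
def sg {n : ℕ} (r : Fin n → Fin n → Bool) (i j : Fin n) : ℤ :=
  (if r i j = true then 1 else 0) - (if r j i = true then 1 else 0)

lemma sg_anti {n : ℕ} (r : Fin n → Fin n → Bool) (i j : Fin n) : sg r i j = - sg r j i := by
  unfold sg; ring

lemma imbalance_eq {n : ℕ} (r : Fin n → Fin n → Bool) (i : Fin n) :
    imbalance r i = ∑ j, sg r i j := by
  unfold imbalance outdeg indeg sg
  rw [Finset.sum_sub_distrib]
  simp

lemma sum_anti {n : ℕ} (r : Fin n → Fin n → Bool) (S : Finset (Fin n)) :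
    ∑ i ∈ S, ∑ j ∈ S, sg r i j = 0 := by
  have h : ∑ i ∈ S, ∑ j ∈ S, sg r i j = - ∑ i ∈ S, ∑ j ∈ S, sg r i j := by
    conv_lhs => rw [Finset.sum_comm]
    rw [← Finset.sum_neg_distrib]
    refine Finset.sum_congr rfl fun i _ => ?_
    rw [← Finset.sum_neg_distrib]
    exact Finset.sum_congr rfl fun j _ => sg_anti r j i
  linarith

lemma sum_imbalance {n : ℕ} (r : Fin n → Fin n → Bool) : ∑ i, imbalance r i = 0 := by
  simp_rw [imbalance_eq]
  exact sum_anti r Finset.univ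

lemma out_add_in {n : ℕ} (r : Fin n → Fin n → Bool) (hr : IsTournament r) (i : Fin n) :
    outdeg r i + indeg r i + 1 = n := by
  unfold outdeg indeg
  rw [← Finset.card_union_of_disjoint]
  · have : (Finset.univ.filter fun j => r i j = true) ∪ (Finset.univ.filter fun j => r j i = true)
        = Finset.univ.erase i := by
      ext j
      simp only [Finset.mem_union, Finset.mem_filter, Finset.mem_univ, true_and, Finset.mem_erase,
        and_true]
      constructor
      · rintro h rfl
        simp [hr.1] at h
      · intro h
        have := hr.2 i j (Ne.symm h)
        cases h1 : r j i <;> simp_all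
    rw [this, Finset.card_erase_of_mem (Finset.mem_univ _)]
    have := i.pos
    simp; omega
  · rw [Finset.disjoint_left]
    intro j h1 h2
    simp only [Finset.mem_filter, Finset.mem_univ, true_and] at h1 h2
    by_cases h : i = j
    · subst h; simp [hr.1] at h1
    · have := hr.2 i j h
      simp_all

/-- Reverse the arc between `a` and `b`. -/
def flipArc {n : ℕ} (r : Fin n → Fin n → Bool) (a b : Fin n) : Fin n → Fin n → Bool :=
  fun i j => if (i = a ∧ j = b) ∨ (i = b ∧ j = a) then r j i else r i j

lemma flip_tournament {n : ℕ} (r : Fin n → Fin n → Bool) (hr : IsTournament r) (a b : Fin n) :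
    IsTournament (flipArc r a b) := by
  constructor
  · intro i
    simp [flipArc, hr.1]
  · intro i j hij
    have h1 := hr.2 i j hij
    unfold flipArc
    by_cases h : (i = a ∧ j = b) ∨ (i = b ∧ j = a)
    · have h' : (j = a ∧ i = b) ∨ (j = b ∧ i = a) := by tauto
      rw [if_pos h, if_pos h', h1]; simp
    · have h' : ¬ ((j = a ∧ i = b) ∨ (j = b ∧ i = a)) := by tauto
      rw [if_neg h, if_neg h', h1]

lemma flip_imbalance {n : ℕ} (r : Fin n → Fin n → Bool) (hr : IsTournament r) (a b : Fin n)
    (hab : r a b = true) (i : Fin n) :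
    imbalance (flipArc r a b) i
      = imbalance r i - (if i = a then 2 else 0) + (if i = b then 2 else 0) := by
  have hne : a ≠ b := by rintro rfl; simp [hr.1] at hab
  have hba : r b a = false := by
    have := hr.2 a b hne; simp_all
  have key : ∀ j, sg (flipArc r a b) i j = sg r i j
      - (if j = b then (if i = a then 2 else 0) else 0)
      + (if j = a then (if i = b then 2 else 0) else 0) := by
    intro j
    unfold sg flipArc
    by_cases h1 : i = a <;> by_cases h2 : i = b <;> by_cases h3 : j = a <;> by_cases h4 : j = b <;>
      simp_all
  rw [imbalance_eq, imbalance_eq, Finset.sum_congr rfl fun j _ => key j, Finset.sum_add_distrib,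
    Finset.sum_sub_distrib]
  simp

lemma path_reverse {n : ℕ} (f : ℕ → Fin n) (m : ℕ) : ∀ (r : Fin n → Fin n → Bool),
    IsTournament r → (∀ i j, i ≤ m → j ≤ m → f i = f j → i = j) →
    (∀ i, i < m → r (f i) (f (i + 1)) = true) →
    ∃ r', IsTournament r' ∧ ∀ i, imbalance r' i
      = imbalance r i - (if i = f 0 then 2 else 0) + (if i = f m then 2 else 0) := by
  induction m with
  | zero =>
    intro r hr _ _
    exact ⟨r, hr, fun i => by ring⟩
  | succ m ih =>
    intro r hr hinj harc
    have hlast := harc m (by omega)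
    obtain ⟨r', h1, h2⟩ := ih (flipArc r (f m) (f (m + 1))) (flip_tournament r hr _ _)
      (fun i j hi hj => hinj i j (by omega) (by omega)) (by
        intro i hi
        have ha := harc i (by omega)
        have e1 : f i ≠ f (m + 1) := fun h => by
          have := hinj i (m + 1) (by omega) (by omega) h; omega
        have e2 : f (i + 1) ≠ f (m + 1) := fun h => by
          have := hinj (i + 1) (m + 1) (by omega) (by omega) h; omega
        simp [flipArc, e1, e2, ha])
    refine ⟨r', h1, fun i => ?_⟩
    rw [h2, flip_imbalance r hr _ _ hlast]
    ring

/-- Reachability through an injective path. -/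
def Reach {n : ℕ} (r : Fin n → Fin n → Bool) (u v : Fin n) : Prop :=
  ∃ (f : ℕ → Fin n) (m : ℕ), f 0 = u ∧ f m = v ∧
    (∀ i j, i ≤ m → j ≤ m → f i = f j → i = j) ∧ (∀ i, i < m → r (f i) (f (i + 1)) = true)

lemma reach_step {n : ℕ} (r : Fin n → Fin n → Bool) (u v w : Fin n) (h : Reach r u v)
    (hvw : r v w = true) : Reach r u w := by
  obtain ⟨f, m, h0, hm, hinj, harc⟩ := h
  by_cases hw : ∃ i, i ≤ m ∧ f i = w
  · obtain ⟨i, hi, hiw⟩ := hw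
    exact ⟨f, i, h0, hiw, fun a b ha hb => hinj a b (by omega) (by omega),
      fun a ha => harc a (by omega)⟩
  · push Not at hw
    refine ⟨fun i => if i ≤ m then f i else w, m + 1, by simp [h0], by simp, ?_, ?_⟩
    · intro i j hi hj hij
      by_cases h1 : i ≤ m <;> by_cases h2 : j ≤ m
      · simp only [h1, h2, if_true] at hij
        exact hinj i j h1 h2 hij
      · simp only [h1, h2, if_true, if_false] at hij
        exact absurd hij (hw i h1)
      · simp only [h1, h2, if_true, if_false] at hij
        exact absurd hij.symm (hw j h2)
      · omega
    · intro i hi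
      by_cases h1 : i < m
      · have a1 : i ≤ m := by omega
        have a2 : i + 1 ≤ m := by omega
        simp only [a1, a2, if_true]
        exact harc i h1
      · have : i = m := by omega
        subst this
        simp [hm, hvw]

lemma landau {k : ℕ} (hk : Odd k) (t : Fin k → ℤ) (hev : ∀ i, Even (t i)) (hsum : ∑ i, t i = 0)
    (hL : ∀ S : Finset (Fin k), -((S.card : ℤ) * (Sᶜ.card : ℤ)) ≤ ∑ i ∈ S, t i) :
    ∃ r : Fin k → Fin k → Bool, IsTournament r ∧ ∀ i, imbalance r i = t i := by
  classical
  suffices H : ∀ N : ℕ, ∀ r : Fin k → Fin k → Bool, IsTournament r →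
      ∑ i, (imbalance r i - t i).natAbs = N →
      ∃ r : Fin k → Fin k → Bool, IsTournament r ∧ ∀ i, imbalance r i = t i by
    refine H _ (fun i j => decide (i < j)) ⟨by simp, ?_⟩ rfl
    intro i j hij
    rcases lt_or_gt_of_ne hij with h | h
    · simp [h, not_lt_of_gt h]
    · simp [h, not_lt_of_gt h]
  intro N
  induction N using Nat.strong_induction_on with
  | _ N ih =>
  intro r hr hN
  by_cases hdone : ∀ i, imbalance r i = t i
  · exact ⟨r, hr, hdone⟩
  have heven : ∀ i, Even (imbalance r i - t i) := by
    intro i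
    have h1 := out_add_in r hr i
    obtain ⟨c, hc⟩ := hk
    obtain ⟨d, hd⟩ := hev i
    unfold imbalance
    exact ⟨outdeg r i - c - d, by rw [hd]; push_cast; omega⟩
  have hz : ∑ i, (imbalance r i - t i) = 0 := by
    rw [Finset.sum_sub_distrib, sum_imbalance, hsum]; simp
  have hu : ∃ u, 0 < imbalance r u - t u := by
    by_contra! hcon
    apply hdone
    intro i
    have := (Finset.sum_eq_zero_iff_of_nonpos (fun i _ => hcon i)).1 hz i (Finset.mem_univ i)
    linarith
  obtain ⟨u, hu⟩ := hu
  by_cases hv : ∃ v, Reach r u v ∧ imbalance r v - t v < 0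
  · obtain ⟨v, ⟨f, m, h0, hm, hinj, harc⟩, hv⟩ := hv
    obtain ⟨r', hr', h'⟩ := path_reverse f m r hr hinj harc
    rw [h0, hm] at h'
    refine ih _ ?_ r' hr' rfl
    rw [← hN]
    have huv : u ≠ v := by rintro rfl; omega
    have hpt : ∀ i, (imbalance r' i - t i).natAbs ≤ (imbalance r i - t i).natAbs := by
      intro i
      obtain ⟨c, hc⟩ := heven i
      rw [h' i]
      by_cases h1 : i = u
      · subst h1
        simp only [huv, if_true, if_false]; omega
      · by_cases h2 : i = v
        · subst h2
          simp only [h1, if_true, if_false]; omega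
        · simp only [h1, h2, if_false]; omega
    refine Finset.sum_lt_sum (fun i _ => hpt i) ⟨u, Finset.mem_univ u, ?_⟩
    obtain ⟨c, hc⟩ := heven u
    rw [h' u]
    simp only [huv, if_true, if_false]; omega
  · exfalso
    push Not at hv
    set S : Finset (Fin k) := Finset.univ.filter fun v => Reach r u v with hS
    have huS : u ∈ S := by
      simp only [hS, Finset.mem_filter, Finset.mem_univ, true_and]
      exact ⟨fun _ => u, 0, rfl, rfl, fun i j hi hj _ => by omega, fun i hi => by omega⟩
    have hlt : ∑ i ∈ S, t i < ∑ i ∈ S, imbalance r i := by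
      refine Finset.sum_lt_sum (fun i hi => ?_) ⟨u, huS, by linarith⟩
      have := hv i (by simpa [hS] using hi)
      linarith
    have heq : ∑ i ∈ S, imbalance r i = -((S.card : ℤ) * (Sᶜ.card : ℤ)) := by
      have : ∀ i ∈ S, imbalance r i = ∑ j ∈ S, sg r i j + -(Sᶜ.card : ℤ) := by
        intro i hi
        rw [imbalance_eq, ← Finset.sum_add_sum_compl S]
        congr 1
        have : ∀ j ∈ Sᶜ, sg r i j = -1 := by
          intro j hj
          have hj' : j ∉ S := by simpa using hj
          have hij : r i j = false := by
            by_contra hc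
            apply hj'
            simp only [hS, Finset.mem_filter, Finset.mem_univ, true_and] at hi ⊢
            exact reach_step r u i j hi (by simpa using hc)
          have hne : i ≠ j := by rintro rfl; exact hj' hi
          have h2 := hr.2 i j hne
          have h3 : r j i = true := by
            rw [hij] at h2; simpa using h2.symm
          simp [sg, hij, h3]
        rw [Finset.sum_congr rfl this]; simp
      rw [Finset.sum_congr rfl this, Finset.sum_add_distrib, sum_anti]
      simp
    have := hL S
    linarith

lemma realize {k : ℕ} (hk : Odd k) (t : Fin k → ℤ) (hev : ∀ i, Even (t i)) (hsum : ∑ i, t i = 0)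
    (p q : ℕ) (hpq : p + q = k) (hlo : ∀ i, -(p : ℤ) ≤ t i) (hhi : ∀ i, t i ≤ q) :
    ∃ r : Fin k → Fin k → Bool, IsTournament r ∧ ∀ i, imbalance r i = t i := by
  refine landau hk t hev hsum fun S => ?_
  have hc : S.card + Sᶜ.card = k := by
    have := Finset.card_add_card_compl S
    simpa using this
  by_cases h : S.card ≤ q
  · have h1 : ∑ i ∈ S, (-(p : ℤ)) ≤ ∑ i ∈ S, t i := Finset.sum_le_sum fun i _ => hlo i
    simp only [Finset.sum_const, nsmul_eq_mul] at h1
    have h2 : (p : ℤ) ≤ Sᶜ.card := by omega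
    nlinarith
  · have h1 : ∑ i ∈ Sᶜ, t i ≤ ∑ i ∈ Sᶜ, (q : ℤ) := Finset.sum_le_sum fun i _ => hhi i
    simp only [Finset.sum_const, nsmul_eq_mul] at h1
    have h2 : (q : ℤ) ≤ S.card := by omega
    have h3 := Finset.sum_add_sum_compl S t
    nlinarith

lemma realize_mult (Z : Finset ℤ) (hev : ∀ z ∈ Z, Even z) (a : ℤ → ℕ) (ha : ∀ z ∈ Z, 0 < a z)
    (hk : Odd (∑ z ∈ Z, a z)) (hsum : ∑ z ∈ Z, (a z : ℤ) * z = 0)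
    (p q : ℕ) (hpq : p + q = ∑ z ∈ Z, a z)
    (hlo : ∀ z ∈ Z, -(p : ℤ) ≤ z) (hhi : ∀ z ∈ Z, z ≤ q) :
    ∃ r : Fin (∑ z ∈ Z, a z) → Fin (∑ z ∈ Z, a z) → Bool,
      IsTournament r ∧ imbalanceSet r = Z := by
  classical
  have hcard : Fintype.card (Σ z : Z, Fin (a z)) = ∑ z ∈ Z, a z := by
    rw [Fintype.card_sigma]
    simp only [Fintype.card_fin]
    exact Finset.sum_coe_sort Z a
  let e : Fin (∑ z ∈ Z, a z) ≃ (Σ z : Z, Fin (a z)) := (Fintype.equivFinOfCardEq hcard).symm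
  let t : Fin (∑ z ∈ Z, a z) → ℤ := fun i => ((e i).1 : ℤ)
  have hmem : ∀ i, t i ∈ Z := fun i => (e i).1.2
  obtain ⟨r, hr, him⟩ := realize hk t (fun i => hev _ (hmem i)) (by
    have h1 : ∑ i, t i = ∑ s : (Σ z : Z, Fin (a z)), (s.1 : ℤ) :=
      Equiv.sum_comp e (fun s : (Σ z : Z, Fin (a z)) => (s.1 : ℤ))
    rw [h1, Fintype.sum_sigma]
    simp only [Finset.sum_const, Finset.card_univ, Fintype.card_fin, nsmul_eq_mul]
    rw [← hsum]
    exact Finset.sum_coe_sort Z (fun z => (a z : ℤ) * z)) p q hpq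
    (fun i => hlo _ (hmem i)) (fun i => hhi _ (hmem i))
  refine ⟨r, hr, ?_⟩
  ext z
  simp only [imbalanceSet, Finset.mem_image, Finset.mem_univ, true_and]
  constructor
  · rintro ⟨i, rfl⟩
    rw [him]; exact hmem i
  · intro hz
    refine ⟨e.symm ⟨⟨z, hz⟩, ⟨0, ha z hz⟩⟩, ?_⟩
    rw [him]
    simp [t]

/-- `z` is `2 ^ v` times an odd number. -/
def TwoPart (v : ℕ) (z : ℤ) : Prop := ∃ c, Odd c ∧ z = 2 ^ v * c

lemma exists_twoPart (z : ℤ) (hz : z ≠ 0) : ∃ v, TwoPart v z := by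
  obtain ⟨v, m, hm, h⟩ := Nat.exists_eq_two_pow_mul_odd (n := z.natAbs) (by simpa using hz)
  have hm' : Odd (m : ℤ) := by exact_mod_cast hm
  rcases Int.natAbs_eq z with h' | h'
  · exact ⟨v, m, hm', by rw [h', h]; push_cast; rfl⟩
  · exact ⟨v, -m, hm'.neg, by rw [h', h]; push_cast; ring⟩

lemma twoPart_unique (v w : ℕ) (z : ℤ) (h1 : TwoPart v z) (h2 : TwoPart w z) : v = w := by
  wlog h : v ≤ w generalizing v w
  · exact (this w v h2 h1 (by omega)).symm
  obtain ⟨c, hc, h1⟩ := h1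
  obtain ⟨d, hd, h2⟩ := h2
  obtain ⟨m, rfl⟩ := Nat.exists_eq_add_of_le h
  rcases m with _ | m
  · rfl
  · exfalso
    rw [h1, pow_add, mul_assoc] at h2
    have := mul_left_cancel₀ (by positivity) h2
    rw [this, pow_succ] at hc
    have : Even ((2 : ℤ) ^ m * 2 * d) := ⟨2 ^ m * d, by ring⟩
    exact (Int.not_odd_iff_even.2 this) hc

/-- Ratio extraction for a pair with different 2-parts. -/
lemma pair_ratio (x y : ℤ) (hx : 0 < x) (hy : 0 < y) (hxe : Even x) (hye : Even y)
    (h : ∀ v, TwoPart v x → TwoPart v y → False) :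
    ∃ a b : ℕ, 0 < a ∧ 0 < b ∧ (b : ℤ) * x = a * y ∧ Odd (a + b) ∧ (a + b : ℤ) < x + y := by
  obtain ⟨x, rfl⟩ := Int.eq_ofNat_of_zero_le hx.le
  obtain ⟨y, rfl⟩ := Int.eq_ofNat_of_zero_le hy.le
  have hx0 : 0 < x := by exact_mod_cast hx
  have hy0 : 0 < y := by exact_mod_cast hy
  have hxe' : Even x := by exact_mod_cast hxe
  have hye' : Even y := by exact_mod_cast hye
  obtain ⟨a, b, hcop, hxa, hyb⟩ := Nat.exists_coprime x y
  set g := x.gcd y with hg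
  have hg2 : 2 ≤ g := by
    have h2 : 2 ∣ g := Nat.dvd_gcd hxe'.two_dvd hye'.two_dvd
    have : 0 < g := Nat.gcd_pos_of_pos_left _ hx0
    exact Nat.le_of_dvd this h2
  have ha : 0 < a := by rcases Nat.eq_zero_or_pos a with h | h; · simp [h] at hxa; omega
                        · exact h
  have hb : 0 < b := by rcases Nat.eq_zero_or_pos b with h | h; · simp [h] at hyb; omega
                        · exact h
  refine ⟨a, b, ha, hb, ?_, ?_, ?_⟩
  · have : b * x = a * y := by rw [hxa, hyb]; ring
    exact_mod_cast this
  · by_contra hodd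
    rw [Nat.not_odd_iff_even, Nat.even_add] at hodd
    by_cases hae : Even a
    · have hbe := hodd.1 hae
      have := Nat.dvd_gcd hae.two_dvd hbe.two_dvd
      rw [hcop] at this
      omega
    · have hbo : Odd b := Nat.not_even_iff_odd.1 fun h => hae (hodd.2 h)
      have hao : Odd a := Nat.not_even_iff_odd.1 hae
      obtain ⟨v, c, hc, hgc⟩ := exists_twoPart (g : ℤ) (by omega)
      have hao' : Odd (a : ℤ) := by exact_mod_cast hao
      have hbo' : Odd (b : ℤ) := by exact_mod_cast hbo
      have e1 : (x : ℤ) = a * g := by exact_mod_cast hxa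
      have e2 : (y : ℤ) = b * g := by exact_mod_cast hyb
      exact h v ⟨a * c, hao'.mul hc, by rw [e1, hgc]; ring⟩
        ⟨b * c, hbo'.mul hc, by rw [e2, hgc]; ring⟩
  · have : a + b < x + y := by nlinarith
    exact_mod_cast this

lemma exists_pair (Z X Y : Finset ℤ)
    (heven : ∀ z ∈ Z, Even z) (h0 : (0 : ℤ) ∉ Z)
    (hZ : Z = X ∪ Y) (hXne : X.Nonempty) (hYne : Y.Nonempty)
    (hreal : ∃ (k : ℕ) (r : Fin k → Fin k → Bool),
      IsTournament r ∧ imbalanceSet r = Z) :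
    ∃ x ∈ X, ∃ y ∈ Y, ∀ v, TwoPart v x → TwoPart v (-y) → False := by
  by_contra! hcon
  obtain ⟨x0, hx0⟩ := hXne
  obtain ⟨y0, hy0⟩ := hYne
  have hneg : ∀ v z, TwoPart v (-z) → TwoPart v z := by
    rintro v z ⟨c, hc, h⟩
    exact ⟨-c, hc.neg, by linarith⟩
  obtain ⟨v, hvx, hvy, -⟩ := hcon x0 hx0 y0 hy0
  have hall : ∀ z ∈ Z, TwoPart v z := by
    intro z hz
    rw [hZ, Finset.mem_union] at hz
    rcases hz with hz | hz
    · obtain ⟨w, h1, h2, -⟩ := hcon z hz y0 hy0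
      rwa [twoPart_unique v w _ hvy h2]
    · obtain ⟨w, h1, h2, -⟩ := hcon x0 hx0 z hz
      rw [twoPart_unique v w _ hvx h1]
      exact hneg _ _ h2
  obtain ⟨k, r, hr, hrZ⟩ := hreal
  have hmem : ∀ i, imbalance r i ∈ Z := fun i => by
    rw [← hrZ]; exact Finset.mem_image_of_mem _ (Finset.mem_univ i)
  have hk : Odd k := by
    have : x0 ∈ imbalanceSet r := by rw [hrZ, hZ]; exact Finset.mem_union_left _ hx0
    obtain ⟨i, -, -⟩ := Finset.mem_image.1 this
    have h1 := out_add_in r hr i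
    obtain ⟨c, hc⟩ := heven _ (hmem i)
    unfold imbalance at hc
    rw [Nat.odd_iff]
    omega
  choose c hc hic using fun i => hall _ (hmem i)
  have hs := sum_imbalance r
  simp_rw [hic] at hs
  rw [← Finset.mul_sum] at hs
  have hs' : ∑ i, c i = 0 := by
    rcases mul_eq_zero.1 hs with h | h
    · exact absurd h (by positivity)
    · exact h
  choose d hd using hc
  simp_rw [hd] at hs'
  rw [Finset.sum_add_distrib, ← Finset.mul_sum] at hs'
  simp only [Finset.sum_const, Finset.card_univ, Fintype.card_fin, nsmul_eq_mul, mul_one] at hs'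
  obtain ⟨e, he⟩ := hk
  omega

end helpers

/-- In the even case with `0 ∉ Z`, if `Z` is a tournament imbalance
set then the minimal order of a tournament realizing `Z` is less than `2n`. -/
theorem even_min_order_lt_of_zero_not_mem (Z X Y : Finset ℤ)
    (hZne : Z.Nonempty) (heven : ∀ z ∈ Z, Even z) (h0 : (0 : ℤ) ∉ Z)
    (hZ : Z = X ∪ Y) (hXne : X.Nonempty) (hYne : Y.Nonempty)
    (hX : ∀ x ∈ X, 0 < x) (hY : ∀ y ∈ Y, y < 0)
    (hreal : ∃ (k : ℕ) (r : Fin k → Fin k → Bool),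
      IsTournament r ∧ imbalanceSet r = Z)
    (L M : ℤ) (hL : L = ∑ x ∈ X, x) (hM : M = ∑ y ∈ Y, -y)
    (n : ℕ) (hn : (n : ℤ) = X.card * M + Y.card * L) :
    sInf {k : ℕ | ∃ r : Fin k → Fin k → Bool,
      IsTournament r ∧ imbalanceSet r = Z} < 2 * n := by
  classical
  obtain ⟨x, hx, y, hy, hxy⟩ := exists_pair Z X Y heven h0 hZ hXne hYne hreal
  have hxZ : ∀ z ∈ X, z ∈ Z := fun z hz => by rw [hZ]; exact Finset.mem_union_left _ hz
  have hyZ : ∀ z ∈ Y, z ∈ Z := fun z hz => by rw [hZ]; exact Finset.mem_union_right _ hz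
  obtain ⟨a, b, ha, hb, hab, hodd, hlt⟩ := pair_ratio x (-y) (hX x hx) (by have := hY y hy; omega)
    (heven _ (hxZ _ hx)) (heven _ (hyZ _ hy)).neg hxy
  have hdisj : Disjoint X Y := by
    rw [Finset.disjoint_left]
    intro z h1 h2
    have := hX z h1
    have := hY z h2
    omega
  have hxL : ∀ z ∈ X, z ≤ L := fun z hz => by
    rw [hL]; exact Finset.single_le_sum (f := fun z : ℤ => z) (fun i hi => (hX i hi).le) hz
  have hyM : ∀ z ∈ Y, -z ≤ M := fun z hz => by
    rw [hM]
    exact Finset.single_le_sum (f := fun z : ℤ => -z) (fun i hi => by have := hY i hi; omega) hz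
  have hLe : Even L := by rw [hL]; exact Finset.even_sum _ fun z hz => heven _ (hxZ z hz)
  have hMe : Even M := by rw [hM]; exact Finset.even_sum _ fun z hz => (heven _ (hyZ z hz)).neg
  have hLpos : 0 < L := lt_of_lt_of_le (hX x hx) (hxL x hx)
  have hMpos : 0 < M := by have := hyM y hy; have := hY y hy; omega
  have hl : (1 : ℤ) ≤ X.card := by exact_mod_cast hXne.card_pos
  have hm : (1 : ℤ) ≤ Y.card := by exact_mod_cast hYne.card_pos
  lift L to ℕ using hLpos.le
  lift M to ℕ using hMpos.le
  let f : ℤ → ℕ := fun z =>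
    if 0 < z then M + (if z = x then b else 0) else L + (if z = y then a else 0)
  have hfX : ∀ z ∈ X, f z = M + (if z = x then b else 0) := fun z hz => by
    simp [f, hX z hz]
  have hfY : ∀ z ∈ Y, f z = L + (if z = y then a else 0) := fun z hz => by
    simp [f, (hY z hz).le]
  have hsX : ∑ z ∈ X, f z = X.card * M + b := by
    rw [Finset.sum_congr rfl hfX, Finset.sum_add_distrib]
    simp [hx]
  have hsY : ∑ z ∈ Y, f z = Y.card * L + a := by
    rw [Finset.sum_congr rfl hfY, Finset.sum_add_distrib]
    simp [hy]
  have hsZ : ∑ z ∈ Z, f z = ∑ z ∈ X, f z + ∑ z ∈ Y, f z := by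
    rw [hZ, Finset.sum_union hdisj]
  have hn' : n = X.card * M + Y.card * L := by exact_mod_cast hn
  have htot : ∑ z ∈ Z, f z = n + (a + b) := by rw [hsZ, hsX, hsY, hn']; ring
  have hne : Even n := by
    have hLe' : Even L := by exact_mod_cast hLe
    have hMe' : Even M := by exact_mod_cast hMe
    rw [hn']
    exact (hMe'.mul_left _).add (hLe'.mul_left _)
  have hwX : ∑ z ∈ X, (f z : ℤ) * z = M * L + b * x := by
    have : ∀ z ∈ X, (f z : ℤ) * z = M * z + (if z = x then b * x else 0) := fun z hz => by
      rw [hfX z hz]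
      by_cases h : z = x
      · subst h; simp; ring
      · simp [h]
    rw [Finset.sum_congr rfl this, Finset.sum_add_distrib, ← Finset.mul_sum, ← hL]
    simp [hx]
  have hwY : ∑ z ∈ Y, (f z : ℤ) * z = - (L * M) + a * y := by
    have : ∀ z ∈ Y, (f z : ℤ) * z = -(L * (-z)) + (if z = y then a * y else 0) := fun z hz => by
      rw [hfY z hz]
      by_cases h : z = y
      · subst h; simp; ring
      · simp [h]
    rw [Finset.sum_congr rfl this, Finset.sum_add_distrib, Finset.sum_neg_distrib,
      ← Finset.mul_sum, ← hM]
    simp [hy]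
  have hMl : (M : ℤ) ≤ X.card * M := by nlinarith
  have hLm : (L : ℤ) ≤ Y.card * L := by nlinarith
  have hmemset := realize_mult Z heven f (fun z hz => by
      rw [hZ, Finset.mem_union] at hz
      rcases hz with h | h
      · rw [hfX z h]; omega
      · rw [hfY z h]; omega)
    (by rw [htot]; exact hne.add_odd hodd)
    (by rw [hZ, Finset.sum_union hdisj, hwX, hwY]; linarith)
    (∑ z ∈ X, f z) (∑ z ∈ Y, f z) hsZ.symm
    (fun z hz => by
      rw [hsX]; push_cast
      rw [hZ, Finset.mem_union] at hz
      rcases hz with h | h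
      · have := hX z h
        linarith
      · have := hyM z h
        linarith)
    (fun z hz => by
      rw [hsY]; push_cast
      rw [hZ, Finset.mem_union] at hz
      rcases hz with h | h
      · have := hxL z h
        linarith
      · have := hY z h
        linarith)
  refine lt_of_le_of_lt (Nat.sInf_le hmemset) ?_
  rw [htot]
  have h1 := hxL x hx
  have h2 := hyM y hy
  zify
  linarith
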